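/- arXiv:2407.13052 — 3 statements merged into one kernel-verified Lean document; each statement's English description precedes it below -/
import Mathlib

section
/- Let I and L be finite sets, c : L → ℕ with ∑_{l ∈ L} c(l) = |I|, and g : I × L → ℝ. Let (u, v) be a feasible dual solution for g whose dual value equals V*(g), let π' be any feasible assignment, and define modified weights ĝ by ĝ(i,l) = u(i) + v(l) if π'(i) = l and ĝ(i,l) = g(i,l) otherwise. Then (u, v) is also a feasible dual solution for ĝ, every feasible assignment π̂ with V_{π̂}(g) = V*(g) also satisfies V_{π̂}(ĝ) = V*(g), and V*(ĝ) = V*(g). -/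
/-- An assignment `π : I → L` is feasible w.r.t. capacities `c` if at most `c l`
refugees are assigned to each location `l`. -/
def Feasible {I L : Type*} [Fintype I] [DecidableEq L] (c : L → ℕ) (π : I → L) : Prop :=
  ∀ l : L, (Finset.univ.filter fun i => π i = l).card ≤ c l

/-- The value `V_π(g) = ∑ i, g (i, π i)` of an assignment `π` under weights `g`. -/
def assignVal {I L : Type*} [Fintype I] (g : I → L → ℝ) (π : I → L) : ℝ :=
  ∑ i, g i (π i)

/-- Weak duality: a feasible assignment is worth at most the value of any feasible dual solution. -/
theorem assignVal_le_dualVal {I L : Type*} [Fintype I] [Fintype L] [DecidableEq L]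
    {c : L → ℕ} {g : I → L → ℝ} {u : I → ℝ} {v : L → ℝ} (hv : ∀ l, 0 ≤ v l)
    (hdual : ∀ i l, g i l ≤ u i + v l) {π : I → L} (hπ : Feasible c π) :
    assignVal g π ≤ ∑ i, u i + ∑ l, (c l : ℝ) * v l := by
  have hfiber : ∑ i, v (π i) =
      ∑ l, ((Finset.univ.filter fun i => π i = l).card : ℝ) * v l := by
    simp [← Finset.sum_fiberwise' Finset.univ π v]
  calc assignVal g π ≤ ∑ i, (u i + v (π i)) := Finset.sum_le_sum fun i _ => hdual i (π i)
    _ = ∑ i, u i + ∑ l, ((Finset.univ.filter fun i => π i = l).card : ℝ) * v l := by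
      rw [Finset.sum_add_distrib, hfiber]
    _ ≤ ∑ i, u i + ∑ l, (c l : ℝ) * v l := by
      gcongr with l
      · exact hv l
      · exact hπ l

/-- The value of an assignment is monotone in the weights. -/
theorem assignVal_mono {I L : Type*} [Fintype I] {g h : I → L → ℝ}
    (hgh : ∀ i l, g i l ≤ h i l) (π : I → L) : assignVal g π ≤ assignVal h π :=
  Finset.sum_le_sum fun i _ => hgh i (π i)

/-- Let `(u, v)` be a feasible dual solution for `g` with dual value
`V*(g)`, `π'` any feasible assignment, and `ĝ (i,l) = u i + v l` if `π' i = l`, else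
`g (i,l)`. Then `(u, v)` is dual feasible for `ĝ`, every `g`-optimal feasible
assignment is still worth `V*(g)` under `ĝ`, and `V*(ĝ) = V*(g)`. -/
theorem modified_weights_preserve_optimum {I L : Type*} [Fintype I] [Fintype L] [DecidableEq L]
    (c : L → ℕ) (hc : ∑ l : L, c l = Fintype.card I)
    (g : I → L → ℝ) (u : I → ℝ) (v : L → ℝ) (Vstar : ℝ)
    (hu : ∀ i, 0 ≤ u i) (hv : ∀ l, 0 ≤ v l)
    (hdualfeas : ∀ i l, g i l ≤ u i + v l)
    (hV : IsGreatest {x | ∃ π : I → L, Feasible c π ∧ x = assignVal g π} Vstar)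
    (hdualval : ∑ i : I, u i + ∑ l : L, (c l : ℝ) * v l = Vstar)
    (π' : I → L) (hπ' : Feasible c π')
    (ghat : I → L → ℝ)
    (hghat : ∀ i l, ghat i l = if π' i = l then u i + v l else g i l) :
    (∀ i l, ghat i l ≤ u i + v l) ∧
    (∀ πhat : I → L, Feasible c πhat → assignVal g πhat = Vstar →
      assignVal ghat πhat = Vstar) ∧
    IsGreatest {x | ∃ π : I → L, Feasible c π ∧ x = assignVal ghat π} Vstar := by
  have hdual : ∀ i l, ghat i l ≤ u i + v l := by
    intro i l
    rw [hghat]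
    split_ifs
    · exact le_rfl
    · exact hdualfeas i l
  have hle : ∀ i l, g i l ≤ ghat i l := by
    intro i l
    rw [hghat]
    split_ifs
    · exact hdualfeas i l
    · exact le_rfl
  have hupper : ∀ π : I → L, Feasible c π → assignVal ghat π ≤ Vstar := fun π hπ =>
    hdualval ▸ assignVal_le_dualVal hv hdual hπ
  have hopt : ∀ π : I → L, Feasible c π → assignVal g π = Vstar →
      assignVal ghat π = Vstar := fun π hπ h =>
    (hupper π hπ).antisymm (h ▸ assignVal_mono hle π)
  refine ⟨hdual, hopt, ?_, ?_⟩
  · obtain ⟨π, hπ, h⟩ := hV.1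
    exact ⟨π, hπ, (hopt π hπ h.symm).symm⟩
  · rintro x ⟨π, hπ, rfl⟩
    exact hupper π hπ
end

section
/- Let I and L be finite sets, c : L → ℕ with ∑_{l ∈ L} c(l) = |I|, and g : I × L → ℝ. Let (u, v) be a feasible dual solution for g whose dual value equals V*(g), let π' be any feasible assignment, and define ĝ(i,l) = u(i) + v(l) if π'(i) = l and ĝ(i,l) = g(i,l) otherwise. Then the L1 modification cost equals the optimality gap of π': ‖ĝ − g‖₁ = ∑_{i ∈ I, l ∈ L} |ĝ(i,l) − g(i,l)| = V*(g) − V_{π'}(g). -/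
/-- A feasible assignment fills every location when the total capacity is the number of
refugees. -/
theorem Feasible.card_fiber_eq {I L : Type*} [Fintype I] [Fintype L] [DecidableEq L]
    {c : L → ℕ} {π : I → L} (hπ : Feasible c π) (hc : ∑ l, c l = Fintype.card I) (l : L) :
    (Finset.univ.filter fun i => π i = l).card = c l := by
  have hsum : ∑ l, (Finset.univ.filter fun i => π i = l).card = ∑ l, c l := by
    rw [hc, ← Finset.card_univ]
    exact (Finset.card_eq_sum_card_fiberwise fun i _ => Finset.mem_coe.2 (Finset.mem_univ _)).symm
  exact (Finset.sum_eq_sum_iff_of_le fun l _ => hπ l).1 hsum l (Finset.mem_univ l)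

/-- Location prices summed along a feasible assignment are weighted by the capacities. -/
theorem Feasible.sum_comp_eq {I L : Type*} [Fintype I] [Fintype L] [DecidableEq L]
    {c : L → ℕ} {π : I → L} (hπ : Feasible c π) (hc : ∑ l, c l = Fintype.card I) (v : L → ℝ) :
    ∑ i, v (π i) = ∑ l, (c l : ℝ) * v l := by
  rw [← Finset.sum_fiberwise Finset.univ π]
  refine Finset.sum_congr rfl fun l _ => ?_
  rw [Finset.sum_congr rfl fun i hi => congrArg v (Finset.mem_filter.1 hi).2,
    Finset.sum_const, hπ.card_fiber_eq hc, nsmul_eq_mul]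

/-- Let `(u, v)` be a feasible dual solution for `g` with dual value
`V*(g)`, `π'` any feasible assignment, and `ĝ (i,l) = u i + v l` if `π' i = l`, else
`g (i,l)`. Then the L1 modification cost equals the optimality gap of `π'`:
`‖ĝ − g‖₁ = V*(g) − V_{π'}(g)`. -/
theorem modification_cost_eq_optimality_gap {I L : Type*} [Fintype I] [Fintype L] [DecidableEq L]
    (c : L → ℕ) (hc : ∑ l : L, c l = Fintype.card I)
    (g : I → L → ℝ) (u : I → ℝ) (v : L → ℝ) (Vstar : ℝ)
    (hu : ∀ i, 0 ≤ u i) (hv : ∀ l, 0 ≤ v l)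
    (hdualfeas : ∀ i l, g i l ≤ u i + v l)
    (hV : IsGreatest {x | ∃ π : I → L, Feasible c π ∧ x = assignVal g π} Vstar)
    (hdualval : ∑ i : I, u i + ∑ l : L, (c l : ℝ) * v l = Vstar)
    (π' : I → L) (hπ' : Feasible c π')
    (ghat : I → L → ℝ)
    (hghat : ∀ i l, ghat i l = if π' i = l then u i + v l else g i l) :
    ∑ i : I, ∑ l : L, |ghat i l - g i l| = Vstar - assignVal g π' := by
  have hrow (i : I) : ∑ l, |ghat i l - g i l| = u i + v (π' i) - g i (π' i) := by
    rw [Finset.sum_eq_single (π' i)]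
    · rw [hghat, if_pos rfl, abs_of_nonneg (sub_nonneg.2 (hdualfeas _ _))]
    · intro l _ hl
      rw [hghat, if_neg hl.symm, sub_self, abs_zero]
    · exact fun h => absurd (Finset.mem_univ _) h
  simp only [hrow, Finset.sum_sub_distrib, Finset.sum_add_distrib]
  rw [hπ'.sum_comp_eq hc, hdualval, assignVal]
end

section
/- Let I and L be finite sets, c : L → ℕ with ∑_{l ∈ L} c(l) = |I|, and g : I × L → ℝ with g(i,l) ≥ 0 for all i, l. Let π' be any feasible assignment. Then the inverse assignment problem has optimal value equal to the optimality gap of π': the minimum of ‖g' − g‖₁ over all weight functions g' : I × L → ℝ such that π' maximizes V_·(g') over feasible assignments equals V*(g) − V_{π'}(g), and this minimum is attained. (This is the Proposition establishing equality in the paper's proof of Theorem 1.) -/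
/-- If every permutation has nonnegative total cost and loops are free, then every closed walk
has nonnegative cost. -/
lemma closedWalk_cost_nonneg {I : Type*} [Fintype I] (d : I → I → ℝ) (hd : ∀ i, d i i = 0)
    (hσ : ∀ σ : Equiv.Perm I, 0 ≤ ∑ i, d i (σ i)) (n : ℕ) :
    ∀ f : ℕ → I, f n = f 0 → 0 ≤ ∑ k ∈ Finset.range n, d (f k) (f (k + 1)) := by
  classical
  induction n using Nat.strong_induction_on with
  | _ n ih =>
    intro f hf
    by_cases hinj : Function.Injective fun k : Fin n => f k
    · rcases n with _ | m
      · simp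
      let e : Fin (m + 1) ↪ I := ⟨fun k => f k, hinj⟩
      let σ : Equiv.Perm I := (finRotate (m + 1)).viaFintypeEmbedding e
      have hstep (k : Fin (m + 1)) : σ (f k) = f (k + 1) := by
        have h : σ (e k) = e (finRotate (m + 1) k) :=
          Equiv.Perm.viaFintypeEmbedding_apply_image _ _ _
        refine h.trans ?_
        change f (finRotate (m + 1) k : Fin (m + 1)) = f (k + 1)
        rw [coe_finRotate]
        split_ifs with hk
        · subst hk
          simpa using hf.symm
        · rfl
      have hsum : ∑ i, d i (σ i) = ∑ k : Fin (m + 1), d (f k) (f (k + 1)) := by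
        rw [← Finset.sum_subset (Finset.subset_univ (Finset.univ.map e)), Finset.sum_map]
        · exact Finset.sum_congr rfl fun k _ => by
            change d (f k) (σ (f k)) = _
            rw [hstep]
        · intro x _ hx
          have : σ x = x := Equiv.Perm.viaFintypeEmbedding_apply_notMem_range _ _
            (by simpa using hx)
          rw [this, hd]
      rw [← Fin.sum_univ_eq_sum_range (fun k => d (f k) (f (k + 1))), ← hsum]
      exact hσ σ
    · obtain ⟨a, b, hab, hb, hfab⟩ : ∃ a b : ℕ, a < b ∧ b < n ∧ f a = f b := by
        simp only [Function.Injective, not_forall] at hinj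
        obtain ⟨x, y, hxy, hne⟩ := hinj
        rcases lt_or_gt_of_ne hne with h | h
        · exact ⟨x, y, h, y.2, hxy⟩
        · exact ⟨y, x, h, x.2, hxy.symm⟩
      have hinner := ih (b - a) (by omega) (fun k => f (a + k))
        (by simp [Nat.add_sub_cancel' hab.le, hfab])
      have houter := ih (a + (n - b)) (by omega) (fun k => if k ≤ a then f k else f (k + (b - a)))
        (by
          have h₁ : ¬ a + (n - b) ≤ a := by omega
          have h₂ : a + (n - b) + (b - a) = n := by omega
          simp [h₁, h₂, hf])
      have hsplit : ∑ k ∈ Finset.range n, d (f k) (f (k + 1)) =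
          ∑ k ∈ Finset.range a, d (f k) (f (k + 1)) +
          ∑ k ∈ Finset.range (b - a), d (f (a + k)) (f (a + k + 1)) +
          ∑ k ∈ Finset.range (n - b), d (f (b + k)) (f (b + k + 1)) := by
        have hn : n = a + (b - a) + (n - b) := by omega
        have hb' : a + (b - a) = b := by omega
        conv_lhs => rw [hn, Finset.sum_range_add, Finset.sum_range_add, hb']
      have h₁ : ∑ k ∈ Finset.range a, d (if k ≤ a then f k else f (k + (b - a)))
          (if k + 1 ≤ a then f (k + 1) else f (k + 1 + (b - a))) =
          ∑ k ∈ Finset.range a, d (f k) (f (k + 1)) := by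
        refine Finset.sum_congr rfl fun k hk => ?_
        have := Finset.mem_range.1 hk
        rw [if_pos (by omega), if_pos (by omega)]
      have h₂ : ∑ k ∈ Finset.range (n - b), d (if a + k ≤ a then f (a + k) else f (a + k + (b - a)))
          (if a + k + 1 ≤ a then f (a + k + 1) else f (a + k + 1 + (b - a))) =
          ∑ k ∈ Finset.range (n - b), d (f (b + k)) (f (b + k + 1)) := by
        refine Finset.sum_congr rfl fun k _ => ?_
        have e₁ : a + k + (b - a) = b + k := by omega
        have e₂ : a + k + 1 + (b - a) = b + k + 1 := by omega
        rw [if_neg (by omega : ¬ a + k + 1 ≤ a), e₁, e₂]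
        split_ifs with hk
        · obtain rfl : k = 0 := by omega
          simp [hfab]
        · rfl
      rw [Finset.sum_range_add] at houter
      simp only [h₁, h₂] at houter
      simp only [← add_assoc] at hinner
      linarith

/-- Costs that are nonnegative on all permutations and vanish on loops admit a potential. -/
lemma exists_potential {I : Type*} [Fintype I] (d : I → I → ℝ) (hd : ∀ i, d i i = 0)
    (hσ : ∀ σ : Equiv.Perm I, 0 ≤ ∑ i, d i (σ i)) :
    ∃ p : I → ℝ, ∀ i j, p i ≤ d i j + p j := by
  let cost (i : I) (w : ℕ × {f : ℕ → I // f 0 = i}) : ℝ :=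
    ∑ k ∈ Finset.range w.1, d (w.2.1 k) (w.2.1 (k + 1))
  have hbdd (i : I) : BddBelow (Set.range (cost i)) := by
    refine ⟨-∑ j, |d j i|, ?_⟩
    rintro _ ⟨⟨n, f, hf⟩, rfl⟩
    have h := closedWalk_cost_nonneg d hd hσ (n + 1) (fun k => if k ≤ n then f k else f 0) (by simp)
    rw [Finset.sum_range_succ] at h
    have hrest : ∑ k ∈ Finset.range n, d (if k ≤ n then f k else f 0)
        (if k + 1 ≤ n then f (k + 1) else f 0) =
        ∑ k ∈ Finset.range n, d (f k) (f (k + 1)) := by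
      refine Finset.sum_congr rfl fun k hk => ?_
      have := Finset.mem_range.1 hk
      rw [if_pos (by omega), if_pos (by omega)]
    rw [hrest] at h
    have hle : d (f n) i ≤ ∑ j, |d j i| := (le_abs_self _).trans
      (Finset.single_le_sum (f := fun j => |d j i|) (fun _ _ => abs_nonneg _) (Finset.mem_univ _))
    simp only [le_refl, if_true, Nat.not_succ_le_self, if_false, hf] at h
    change -_ ≤ ∑ k ∈ Finset.range n, d (f k) (f (k + 1))
    linarith
  refine ⟨fun i => ⨅ w, cost i w, fun i j => ?_⟩
  have : Nonempty (ℕ × {f : ℕ → I // f 0 = j}) := ⟨0, fun _ => j, rfl⟩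
  rw [← sub_le_iff_le_add']
  refine le_ciInf ?_
  rintro ⟨n, f, hf⟩
  rw [sub_le_iff_le_add']
  refine (ciInf_le (hbdd i) ⟨n + 1, fun k => Nat.casesOn k i f, rfl⟩).trans ?_
  simp only [cost]
  rw [Finset.sum_range_succ', add_comm]
  simp [hf]

/-- When the capacities sum to the number of refugees, feasible assignments fill them exactly. -/
lemma Feasible.card_eq {I L : Type*} [Fintype I] [Fintype L] [DecidableEq L] {c : L → ℕ}
    (hc : ∑ l, c l = Fintype.card I) {π : I → L} (hπ : Feasible c π) (l : L) :
    (Finset.univ.filter fun i => π i = l).card = c l := by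
  refine (Finset.sum_eq_sum_iff_of_le fun l _ => hπ l).1 ?_ l (Finset.mem_univ l)
  rw [hc, ← Finset.card_univ]
  exact (Finset.card_eq_sum_card_fiberwise fun _ _ => Finset.mem_coe.2 (Finset.mem_univ _)).symm

lemma Feasible.sum_comp {I L : Type*} [Fintype I] [Fintype L] [DecidableEq L] {c : L → ℕ}
    (hc : ∑ l, c l = Fintype.card I) {π : I → L} (hπ : Feasible c π) (v : L → ℝ) :
    ∑ i, v (π i) = ∑ l, (c l : ℝ) * v l := by
  rw [← Finset.sum_fiberwise Finset.univ π]
  refine Finset.sum_congr rfl fun l _ => ?_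
  rw [Finset.sum_congr rfl (g := fun _ => v l) fun i hi => by rw [(Finset.mem_filter.1 hi).2],
    Finset.sum_const, hπ.card_eq hc, nsmul_eq_mul]

lemma Feasible.comp_perm {I L : Type*} [Fintype I] [DecidableEq L] {c : L → ℕ} {π : I → L}
    (hπ : Feasible c π) (σ : Equiv.Perm I) : Feasible c (π ∘ σ) := fun l => by
  refine le_trans (le_of_eq ?_) (hπ l)
  exact Finset.card_equiv σ (by simp)

/-- An optimal feasible assignment has dual prices satisfying complementary slackness. -/
lemma exists_dual_prices {I L : Type*} [Fintype I] [DecidableEq L] {c : L → ℕ}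
    (g : I → L → ℝ) {π : I → L} (hπ : Feasible c π)
    (hopt : ∀ ρ, Feasible c ρ → assignVal g ρ ≤ assignVal g π) :
    ∃ (u : I → ℝ) (v : L → ℝ), (∀ i l, g i l ≤ u i + v l) ∧ ∀ i, u i + v (π i) = g i (π i) := by
  obtain ⟨p, hp⟩ := exists_potential (fun i j => g i (π i) - g i (π j)) (by simp) fun σ => by
    have := hopt _ (hπ.comp_perm σ)
    simpa [assignVal, Finset.sum_sub_distrib] using this
  have hle (i : I) (l : L) : g i l - (g i (π i) - p i) ≤ ⨆ j, (g j l - (g j (π j) - p j)) :=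
    le_ciSup (f := fun j => g j l - (g j (π j) - p j)) (Set.finite_range _).bddAbove i
  refine ⟨fun i => g i (π i) - p i, fun l => ⨆ i, (g i l - (g i (π i) - p i)), fun i l => ?_,
    fun i => ?_⟩
  · linarith [hle i l]
  · have : Nonempty I := ⟨i⟩
    have hge : ⨆ j, (g j (π i) - (g j (π j) - p j)) ≤ p i :=
      ciSup_le fun j => by linarith [hp j i]
    linarith [hle i (π i)]

/-- The difference of the changes at two locations is at most the L1 norm of the changes. -/
lemma sub_le_sum_abs {L : Type*} [Fintype L] (h : L → ℝ) (a b : L) :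
    h a - h b ≤ ∑ l, |h l| := by
  classical
  by_cases hab : a = b
  · simpa [hab] using Finset.sum_nonneg fun l _ => abs_nonneg (h l)
  · calc h a - h b ≤ |h a| + |h b| := by linarith [le_abs_self (h a), neg_abs_le (h b)]
      _ = ∑ l ∈ {a, b}, |h l| := (Finset.sum_pair (f := fun l => |h l|) hab).symm
      _ ≤ ∑ l, |h l| :=
        Finset.sum_le_sum_of_subset_of_nonneg (Finset.subset_univ _) fun _ _ _ => abs_nonneg _

/-- The inverse assignment problem: the minimum of `‖g' − g‖₁` over
weight functions `g'` under which the given feasible assignment `π'` is optimal equals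
and attains the optimality gap `V*(g) − V_{π'}(g)`. -/
theorem inverse_assignment_optimal_value {I L : Type*} [Fintype I] [Fintype L] [DecidableEq L]
    (c : L → ℕ) (hc : ∑ l : L, c l = Fintype.card I)
    (g : I → L → ℝ) (hg : ∀ i l, 0 ≤ g i l)
    (π' : I → L) (hπ' : Feasible c π')
    (Vstar : ℝ)
    (hV : IsGreatest {x | ∃ π : I → L, Feasible c π ∧ x = assignVal g π} Vstar) :
    IsLeast {d | ∃ g' : I → L → ℝ,
        (∀ π : I → L, Feasible c π → assignVal g' π ≤ assignVal g' π') ∧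
        d = ∑ i : I, ∑ l : L, |g' i l - g i l|}
      (Vstar - assignVal g π') := by
  obtain ⟨⟨π, hπ, rfl⟩, hub⟩ := hV
  constructor
  · obtain ⟨u, v, hle, heq⟩ := exists_dual_prices g hπ fun ρ hρ => hub ⟨ρ, hρ, rfl⟩
    refine ⟨fun i l => if l = π' i then u i + v l else g i l, fun ρ hρ => ?_, ?_⟩
    · calc assignVal (fun i l => if l = π' i then u i + v l else g i l) ρ
          ≤ ∑ i, (u i + v (ρ i)) := Finset.sum_le_sum fun i _ => by
            dsimp only
            split_ifs
            · exact le_rfl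
            · exact hle i _
        _ = ∑ i, (u i + v (π' i)) := by
            rw [Finset.sum_add_distrib, Finset.sum_add_distrib, hρ.sum_comp hc, hπ'.sum_comp hc]
        _ = assignVal (fun i l => if l = π' i then u i + v l else g i l) π' := by
            simp [assignVal]
    · have hrow (i : I) : ∑ l, |(if l = π' i then u i + v l else g i l) - g i l| =
          u i + v (π' i) - g i (π' i) := by
        rw [Finset.sum_eq_single (π' i) (fun l _ hl => by simp [hl]) (by simp), if_pos rfl]
        exact abs_of_nonneg (sub_nonneg.2 (hle i _))
      have hval : assignVal g π = ∑ i, (u i + v (π' i)) := by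
        rw [Finset.sum_add_distrib, hπ'.sum_comp hc, ← hπ.sum_comp hc, ← Finset.sum_add_distrib]
        exact Finset.sum_congr rfl fun i _ => (heq i).symm
      simp only [hrow]
      rw [Finset.sum_sub_distrib, hval, assignVal]
  · rintro _ ⟨g', hopt, rfl⟩
    have h : ∑ i, ((g' i (π' i) - g i (π' i)) - (g' i (π i) - g i (π i))) ≤
        ∑ i, ∑ l, |g' i l - g i l| :=
      Finset.sum_le_sum fun i _ => sub_le_sum_abs (fun l => g' i l - g i l) (π' i) (π i)
    have h' := hopt π hπ
    simp only [Finset.sum_sub_distrib] at h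
    simp only [assignVal] at h' ⊢
    linarith
end
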